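/- Bound for a in terms of A and B (Lemma 6.3(iii)): Let s > (d+1)/2. There is a constant C, depending on d, s and k, such that for every holomorphic R ∈ H^{s,1/2}(𝕋^d), the function a := i(P̄[conj(R)·∂_α R] − P[R·∂_α conj(R)]) satisfies ‖a‖_{H^s} ≤ C ‖R‖_{H^{s−1/2,1/2}} ‖R‖_{H^{s,1/2}}. -/

import Mathlib

noncomputable section
open scoped BigOperators
open Filter

/-- The frequency lattice `ℤ^d` of the torus `𝕋^d`. -/
abbrev Freq (d : ℕ) := Fin d → ℤ

/-- A function on `𝕋^d`, represented by its sequence of Fourier coefficients. -/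
abbrev Coeffs (d : ℕ) := Freq d → ℂ

variable {d : ℕ}

/-- The pairing `⟨j, k⟩` between a lattice frequency and the frequency vector `k ∈ ℝ^d`. -/
def dotk (k : Fin d → ℝ) (j : Freq d) : ℝ := ∑ i, (j i : ℝ) * k i

/-- The Japanese bracket `⟨j⟩ = (1+|j|²)^{1/2}`. -/
def jb (j : Freq d) : ℝ := Real.sqrt (1 + ∑ i, ((j i : ℝ)) ^ 2)

/-- The entries of `k` are linearly independent over `ℚ` (equivalently, over `ℤ`). -/
def Indep (k : Fin d → ℝ) : Prop := ∀ j : Freq d, dotk k j = 0 → j = 0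

/-- The weight defining the anisotropic Sobolev norm `H^{s,θ}`. -/
def wt (k : Fin d → ℝ) (s θ : ℝ) (j : Freq d) : ℝ :=
  jb j ^ (2 * s) * (1 + (dotk k j) ^ 2) ^ θ

/-- Membership in the anisotropic Sobolev space `H^{s,θ}(𝕋^d)`. -/
def MemSob (k : Fin d → ℝ) (s θ : ℝ) (u : Coeffs d) : Prop :=
  Summable (fun j : Freq d => wt k s θ j * ‖u j‖ ^ 2)

/-- The `H^{s,θ}(𝕋^d)` norm. -/
def sobNorm (k : Fin d → ℝ) (s θ : ℝ) (u : Coeffs d) : ℝ :=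
  Real.sqrt (∑' j : Freq d, wt k s θ j * ‖u j‖ ^ 2)

/-- Membership in the Sobolev space `H^s(𝕋^d)`; `H^0 = L²`. -/
def MemHs (s : ℝ) (u : Coeffs d) : Prop :=
  Summable (fun j : Freq d => jb j ^ (2 * s) * ‖u j‖ ^ 2)

/-- The `H^s(𝕋^d)` norm; for `s = 0` this is the `L²(𝕋^d)` norm (spectrally normalized). -/
def HsNorm (s : ℝ) (u : Coeffs d) : ℝ :=
  Real.sqrt (∑' j : Freq d, jb j ^ (2 * s) * ‖u j‖ ^ 2)

/-- The value of the function with Fourier coefficients `u` at the point `α ∈ 𝕋^d = ℝ^d/(2πℤ)^d`,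
namely `Σ_j û_j e^{i⟨j,α⟩}`. -/
def value (u : Coeffs d) (α : Fin d → ℝ) : ℂ :=
  ∑' j : Freq d, u j * Complex.exp (Complex.I * ((∑ i, (j i : ℝ) * α i : ℝ) : ℂ))

/-- The squared norm of the space `ℋ^σ = H^σ × H^{σ,1/2}`. -/
def HHnormSq (k : Fin d → ℝ) (σ : ℝ) (W R : Coeffs d) : ℝ :=
  HsNorm σ W ^ 2 + sobNorm k σ (1/2) R ^ 2

/-- The norm of the space `ℋ^σ = H^σ × H^{σ,1/2}`. -/
def HHnorm (k : Fin d → ℝ) (σ : ℝ) (W R : Coeffs d) : ℝ :=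
  Real.sqrt (HHnormSq k σ W R)

/-- Membership in `ℋ^σ = H^σ × H^{σ,1/2}`. -/
def MemHH (k : Fin d → ℝ) (σ : ℝ) (W R : Coeffs d) : Prop :=
  MemHs σ W ∧ MemSob k σ (1/2) R

/-- The directional derivative `∂_α = k₁∂₁+⋯+k_d∂_d`, acting on Fourier coefficients
by multiplication by `i⟨j,k⟩`. -/
def dAl (k : Fin d → ℝ) (u : Coeffs d) : Coeffs d :=
  fun j => Complex.I * (dotk k j : ℝ) * u j

/-- The projection `P`: the Fourier multiplier which is `1` for `⟨j,k⟩ < 0`, `1/2`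
at the zero mode, `0` for `⟨j,k⟩ > 0`. -/
def Pp (k : Fin d → ℝ) (u : Coeffs d) : Coeffs d := fun j =>
  if dotk k j < 0 then u j else if dotk k j = 0 then u j / 2 else 0

/-- The complementary projection `P̄ = I - P`. -/
def Pb (k : Fin d → ℝ) (u : Coeffs d) : Coeffs d := u - Pp k u

/-- The Fourier coefficients of the complex conjugate function. -/
def conjC (u : Coeffs d) : Coeffs d := fun j => (starRingEnd ℂ) (u (-j))

/-- The Fourier coefficients of the product of two functions (convolution). -/
def cmul (u v : Coeffs d) : Coeffs d := fun j => ∑' m : Freq d, u m * v (j - m)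

/-- The Fourier coefficients of the constant function `1`. -/
def oneC : Coeffs d := fun j => if j = 0 then 1 else 0

/-- `u` is holomorphic: its Fourier coefficients vanish for `⟨j,k⟩ > 0`. -/
def Holo (k : Fin d → ℝ) (u : Coeffs d) : Prop := ∀ j : Freq d, 0 < dotk k j → u j = 0

/-- The coefficients of `2 Re u`. -/
def twoRe (u : Coeffs d) : Coeffs d := u + conjC u

/-- The coefficients of `2 Im u`. -/
def twoIm (u : Coeffs d) : Coeffs d := fun j => (u j - conjC u j) / Complex.I

/-- The coefficients of `u²`. -/
def csq (u : Coeffs d) : Coeffs d := cmul u u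

/-- The coefficients of `|u|² = u·conj(u)`. -/
def absSqC (u : Coeffs d) : Coeffs d := cmul u (conjC u)

/-- The advection velocity `b := 2 Re P[R(1-conj Y)]`. -/
def bC (k : Fin d → ℝ) (R Y : Coeffs d) : Coeffs d :=
  twoRe (Pp k (cmul R (oneC - conjC Y)))

/-- The frequency shift `a := i(P̄[conj(R)·R_α] - P[R·conj(R)_α])`. -/
def aCf (k : Fin d → ℝ) (R : Coeffs d) : Coeffs d := fun j =>
  Complex.I * ((Pb k (cmul (conjC R) (dAl k R)) - Pp k (cmul R (dAl k (conjC R)))) j)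

/-- The auxiliary function
`M := P̄[conj(R)·Y_α − R_α·conj(Y)] + P[R·conj(Y)_α − conj(R)_α·Y]`. -/
def MCf (k : Fin d → ℝ) (R Y : Coeffs d) : Coeffs d :=
  Pb k (cmul (conjC R) (dAl k Y) - cmul (dAl k R) (conjC Y))
    + Pp k (cmul R (dAl k (conjC Y)) - cmul (dAl k (conjC R)) Y)

/-- `(W,R,Y)` solves the differentiated gravity water wave system on the time interval `I`:
`𝐖_t + b·𝐖_α + (1+𝐖)(1−conj Y)·R_α = (1+𝐖)M` and `R_t + b·R_α = i(Y − a(1−Y))`,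
where `Y = 𝐖/(1+𝐖)` (equivalently `(1+𝐖)·Y = 𝐖`), so that
`(1+𝐖)/(1+conj 𝐖) = (1+𝐖)(1−conj Y)` and `i(𝐖−a)/(1+𝐖) = i(Y − a(1−Y))`. -/
structure IsWWSol (k : Fin d → ℝ) (I : Set ℝ) (W R Y : ℝ → Coeffs d) : Prop where
  holoW : ∀ t ∈ I, Holo k (W t)
  holoR : ∀ t ∈ I, Holo k (R t)
  Ymem : ∀ t ∈ I, MemHs 0 (Y t)
  Ydef : ∀ t ∈ I, cmul (oneC + W t) (Y t) = W t
  eqW : ∀ t ∈ I, ∀ j : Freq d,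
    HasDerivWithinAt (fun τ => W τ j)
      ((cmul (oneC + W t) (MCf k (R t) (Y t))
        - cmul (bC k (R t) (Y t)) (dAl k (W t))
        - cmul (cmul (oneC + W t) (oneC - conjC (Y t))) (dAl k (R t))) j) I t
  eqR : ∀ t ∈ I, ∀ j : Freq d,
    HasDerivWithinAt (fun τ => R τ j)
      ((Complex.I • (Y t - cmul (aCf k (R t)) (oneC - Y t))
        - cmul (bC k (R t) (Y t)) (dAl k (R t))) j) I t

/-- Cauchy–Schwarz for extended nonnegative series. -/
theorem enn_cs {ι : Type*} (a b : ι → ENNReal) :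
    (∑' i, a i * b i) ^ 2 ≤ (∑' i, a i ^ 2) * (∑' i, b i ^ 2) := by
  let _ : MeasurableSpace ι := ⊤
  have h := ENNReal.lintegral_mul_le_Lp_mul_Lq (MeasureTheory.Measure.count (α := ι))
    (p := 2) (q := 2) Real.HolderConjugate.two_two
    (f := a) (g := b) (measurable_from_top.aemeasurable) (measurable_from_top.aemeasurable)
  simp only [MeasureTheory.lintegral_count, Pi.mul_apply, ENNReal.rpow_two] at h
  calc _ ≤ ((∑' i, a i ^ 2) ^ (1 / 2 : ℝ) * (∑' i, b i ^ 2) ^ (1 / 2 : ℝ)) ^ 2 := by gcongr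
    _ = _ := by
      rw [mul_pow, ← ENNReal.rpow_two, ← ENNReal.rpow_two, ← ENNReal.rpow_mul, ← ENNReal.rpow_mul]
      norm_num

/-- Young's inequality `ℓ² * ℓ¹ ⊂ ℓ²`. -/
theorem enn_young {A : Type*} [AddCommGroup A] (f g : A → ENNReal) :
    ∑' j, (∑' m, f (m + j) * g m) ^ 2 ≤ (∑' m, g m) ^ 2 * ∑' m, f m ^ 2 := by
  have hsq : ∀ x : ENNReal, (x ^ (1 / 2 : ℝ)) ^ 2 = x := fun x => by
    rw [← ENNReal.rpow_two, ← ENNReal.rpow_mul]; norm_num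
  have h1 : ∀ j, (∑' m, f (m + j) * g m) ^ 2 ≤ (∑' m, f (m + j) ^ 2 * g m) * ∑' m, g m := by
    intro j
    have h := enn_cs (fun m => f (m + j) * g m ^ (1 / 2 : ℝ)) (fun m => g m ^ (1 / 2 : ℝ))
    simp only [mul_pow, hsq] at h
    refine le_trans (le_of_eq ?_) h
    congr 1
    refine tsum_congr fun m => ?_
    rw [mul_assoc, ← sq, hsq]
  calc _ ≤ ∑' j, (∑' m, f (m + j) ^ 2 * g m) * ∑' m, g m := ENNReal.tsum_le_tsum h1
    _ = (∑' m, ∑' j, f (m + j) ^ 2 * g m) * ∑' m, g m := by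
      rw [ENNReal.tsum_mul_right, ENNReal.tsum_comm]
    _ = (∑' m, (∑' j, f j ^ 2) * g m) * ∑' m, g m := by
      congr 1
      refine tsum_congr fun m => ?_
      rw [ENNReal.tsum_mul_right]
      congr 1
      exact (Equiv.addLeft m).tsum_eq (fun j => f j ^ 2)
    _ = _ := by rw [ENNReal.tsum_mul_left]; ring

theorem one_le_jb (j : Freq d) : 1 ≤ jb j := by
  unfold jb
  rw [Real.one_le_sqrt]
  have : 0 ≤ ∑ i, ((j i : ℝ)) ^ 2 := Finset.sum_nonneg fun i _ => sq_nonneg _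
  linarith

theorem jb_sq (j : Freq d) : jb j ^ 2 = 1 + ∑ i, ((j i : ℝ)) ^ 2 := by
  unfold jb
  rw [Real.sq_sqrt]
  have : 0 ≤ ∑ i, ((j i : ℝ)) ^ 2 := Finset.sum_nonneg fun i _ => sq_nonneg _
  linarith

theorem jb_tri (m j : Freq d) : jb j ≤ 2 * max (jb (m + j)) (jb m) := by
  have h1 := one_le_jb (m + j)
  have h2 := one_le_jb m
  have key : jb j ^ 2 ≤ 2 * (jb (m + j) ^ 2 + jb m ^ 2) := by
    rw [jb_sq, jb_sq, jb_sq]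
    have : ∑ i, ((j i : ℝ)) ^ 2 ≤ ∑ i, (2 * (((m + j) i : ℤ) : ℝ) ^ 2 + 2 * (m i : ℝ) ^ 2) := by
      refine Finset.sum_le_sum fun i _ => ?_
      push_cast [Pi.add_apply]
      nlinarith [sq_nonneg ((j i : ℝ) + 2 * m i)]
    rw [Finset.sum_add_distrib, ← Finset.mul_sum, ← Finset.mul_sum] at this
    linarith
  refine le_of_sq_le_sq ?_ (by positivity)
  have h3 : jb (m + j) ^ 2 ≤ (max (jb (m + j)) (jb m)) ^ 2 := by gcongr; exact le_max_left _ _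
  have h4 : jb m ^ 2 ≤ (max (jb (m + j)) (jb m)) ^ 2 := by gcongr; exact le_max_right _ _
  nlinarith

theorem jb_rpow_tri (s : ℝ) (hs : 0 ≤ s) (m j : Freq d) :
    jb j ^ s ≤ 2 ^ s * (jb (m + j) ^ s + jb m ^ s) := by
  have h1 := one_le_jb (m + j)
  have h2 := one_le_jb m
  have h0 := one_le_jb j
  have p1 : 0 ≤ jb (m + j) ^ s := by positivity
  have p2 : 0 ≤ jb m ^ s := by positivity
  calc jb j ^ s ≤ (2 * max (jb (m + j)) (jb m)) ^ s := by gcongr; exact jb_tri m j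
    _ = 2 ^ s * (max (jb (m + j)) (jb m)) ^ s := Real.mul_rpow (by norm_num) (by positivity)
    _ ≤ _ := by
      gcongr
      rcases max_choice (jb (m + j)) (jb m) with h | h <;> rw [h] <;> linarith

theorem norm_le_jb (j : Freq d) : ‖(fun i => (j i : ℝ) : Fin d → ℝ)‖ ≤ jb j := by
  have h0 := one_le_jb j
  rw [pi_norm_le_iff_of_nonneg (by linarith)]
  intro i
  rw [Real.norm_eq_abs]
  refine abs_le_of_sq_le_sq ?_ (by linarith)
  rw [jb_sq]
  have := Finset.single_le_sum (f := fun i => ((j i : ℝ)) ^ 2) (fun i _ => sq_nonneg _)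
    (Finset.mem_univ i)
  linarith

theorem summable_jb (r : ℝ) (hr : r < -(d : ℝ)) : Summable (fun j : Freq d => jb j ^ r) := by
  let L : Submodule ℤ (Fin d → ℝ) := Submodule.span ℤ (Set.range (Pi.basisFun ℝ (Fin d)))
  have hrank : Module.finrank ℤ L = d := by
    rw [ZLattice.rank ℝ L]; simp
  have hL := ZLattice.summable_norm_rpow L r (by rw [hrank]; exact hr)
  have hmem : ∀ j : Freq d, (fun i => (j i : ℝ) : Fin d → ℝ) ∈ L := by
    intro j
    have : (fun i => (j i : ℝ) : Fin d → ℝ) = ∑ i, j i • Pi.basisFun ℝ (Fin d) i := by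
      ext i
      simp [Finset.sum_apply, Pi.single_apply]
    rw [this]
    exact Submodule.sum_mem _ fun i _ => Submodule.smul_mem _ _ (Submodule.subset_span ⟨i, rfl⟩)
  let φ : Freq d → L := fun j => ⟨_, hmem j⟩
  have hφ : Function.Injective φ := by
    intro a b h
    have h' := congrArg Subtype.val h
    ext i
    have := congrFun h' i
    simpa [φ] using this
  have hS := hL.comp_injective hφ
  refine Summable.of_norm_bounded_eventually hS ?_
  refine (Set.finite_singleton (0 : Freq d)).subset ?_
  intro j hj
  by_contra hne
  apply hj
  have h0 := one_le_jb j
  have hne' : j ≠ 0 := hne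
  have hpos : 0 < ‖(fun i => (j i : ℝ) : Fin d → ℝ)‖ := by
    rw [norm_pos_iff]
    intro h
    apply hne'
    ext i
    have := congrFun h i
    simpa using this
  change ‖jb j ^ r‖ ≤ ‖(fun i => (j i : ℝ) : Fin d → ℝ)‖ ^ r
  rw [Real.norm_of_nonneg (by positivity)]
  have hd0 : (0 : ℝ) ≤ d := Nat.cast_nonneg d
  exact Real.rpow_le_rpow_of_nonpos hpos (norm_le_jb j) (by linarith)

theorem dotk_add (k : Fin d → ℝ) (a b : Freq d) : dotk k (a + b) = dotk k a + dotk k b := by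
  simp [dotk, add_mul, Finset.sum_add_distrib]

theorem dotk_neg (k : Fin d → ℝ) (a : Freq d) : dotk k (-a) = -dotk k a := by
  simp [dotk, Finset.sum_neg_distrib]

/-- The half-derivative of `R` in absolute value. -/
def Ghalf (k : Fin d → ℝ) (R : Coeffs d) (m : Freq d) : ENNReal :=
  ENNReal.ofReal (Real.sqrt |dotk k m| * ‖R m‖)

theorem term_bound (k : Fin d → ℝ) (R : Coeffs d) (hR : Holo k R) (p n : Freq d)
    (h : dotk k p ≤ dotk k n) :
    ‖R p‖ₑ * (ENNReal.ofReal |dotk k n| * ‖R n‖ₑ) ≤ Ghalf k R n * Ghalf k R p := by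
  by_cases hn : 0 < dotk k n
  · simp [hR n hn]
  have hn' : dotk k n ≤ 0 := not_lt.mp hn
  unfold Ghalf
  rw [← ofReal_norm, ← ofReal_norm, ← ENNReal.ofReal_mul (by positivity),
    ← ENNReal.ofReal_mul (by positivity), ← ENNReal.ofReal_mul (by positivity)]
  apply ENNReal.ofReal_le_ofReal
  have habs : |dotk k n| ≤ |dotk k p| := by
    rw [abs_of_nonpos hn', abs_of_nonpos (h.trans hn')]; linarith
  have h1 : |dotk k n| ≤ Real.sqrt |dotk k n| * Real.sqrt |dotk k p| := by
    calc |dotk k n| = Real.sqrt |dotk k n| * Real.sqrt |dotk k n| :=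
          (Real.mul_self_sqrt (abs_nonneg _)).symm
      _ ≤ _ := by gcongr
  calc ‖R p‖ * (|dotk k n| * ‖R n‖) = |dotk k n| * (‖R p‖ * ‖R n‖) := by ring
    _ ≤ (Real.sqrt |dotk k n| * Real.sqrt |dotk k p|) * (‖R p‖ * ‖R n‖) := by gcongr
    _ = _ := by ring

theorem enorm_dAl (k : Fin d → ℝ) (u : Coeffs d) (j : Freq d) :
    ‖dAl k u j‖ₑ = ENNReal.ofReal |dotk k j| * ‖u j‖ₑ := by
  unfold dAl
  rw [← ofReal_norm, ← ofReal_norm, ← ENNReal.ofReal_mul (by positivity)]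
  simp

theorem enorm_conjC (u : Coeffs d) (j : Freq d) : ‖conjC u j‖ₑ = ‖u (-j)‖ₑ := by
  unfold conjC
  rw [← ofReal_norm, ← ofReal_norm]
  simp

theorem enorm_cmul_le (u v : Coeffs d) (j : Freq d) :
    ‖cmul u v j‖ₑ ≤ ∑' m, ‖u m‖ₑ * ‖v (j - m)‖ₑ := by
  unfold cmul
  refine enorm_tsum_le_tsum_enorm.trans (le_of_eq ?_)
  simp [enorm_mul]

theorem bound_u (k : Fin d → ℝ) (R : Coeffs d) (hR : Holo k R) (j : Freq d) (hj : 0 ≤ dotk k j) :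
    ‖cmul (conjC R) (dAl k R) j‖ₑ ≤ ∑' m, Ghalf k R (m + j) * Ghalf k R m := by
  refine (enorm_cmul_le _ _ _).trans ?_
  rw [← (Equiv.neg (Freq d)).tsum_eq]
  refine ENNReal.tsum_le_tsum fun m => ?_
  simp only [Equiv.neg_apply, enorm_conjC, enorm_dAl, neg_neg]
  rw [show j - -m = m + j by abel]
  exact term_bound k R hR m (m + j) (by rw [dotk_add]; linarith)

theorem bound_v (k : Fin d → ℝ) (R : Coeffs d) (hR : Holo k R) (j : Freq d) (hj : dotk k j ≤ 0) :
    ‖cmul R (dAl k (conjC R)) j‖ₑ ≤ ∑' m, Ghalf k R (m + j) * Ghalf k R m := by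
  refine (enorm_cmul_le _ _ _).trans ?_
  rw [← (Equiv.addRight j).tsum_eq]
  refine ENNReal.tsum_le_tsum fun m => ?_
  simp only [Equiv.coe_addRight, enorm_conjC, enorm_dAl]
  rw [show j - (m + j) = -m by abel, neg_neg, dotk_neg, abs_neg, mul_comm (Ghalf k R (m + j))]
  exact term_bound k R hR (m + j) m (by rw [dotk_add]; linarith)

theorem enorm_half_le (z : ℂ) : ‖z / 2‖ₑ ≤ ‖z‖ₑ := by
  rw [← ofReal_norm, ← ofReal_norm]
  apply ENNReal.ofReal_le_ofReal
  rw [norm_div]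
  have := norm_nonneg z
  norm_num

theorem bound_a (k : Fin d → ℝ) (R : Coeffs d) (hR : Holo k R) (j : Freq d) :
    ‖aCf k R j‖ₑ ≤ 2 * ∑' m, Ghalf k R (m + j) * Ghalf k R m := by
  have hI : ‖Complex.I‖ₑ = 1 := by rw [← ofReal_norm]; simp
  unfold aCf
  rw [enorm_mul, hI, one_mul]
  simp only [Pb, Pp, Pi.sub_apply]
  rcases lt_trichotomy (dotk k j) 0 with h | h | h
  · rw [if_pos h, if_pos h, sub_self, zero_sub, enorm_neg, two_mul]
    exact (bound_v k R hR j h.le).trans le_self_add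
  · rw [if_neg (by linarith), if_pos h, if_neg (by linarith), if_pos h, sub_half, two_mul]
    refine enorm_sub_le.trans (add_le_add ?_ ?_)
    · exact (enorm_half_le _).trans (bound_u k R hR j h.ge)
    · exact (enorm_half_le _).trans (bound_v k R hR j h.le)
  · rw [if_neg (by linarith), if_neg (by linarith), if_neg (by linarith), if_neg (by linarith),
      sub_zero, sub_zero, two_mul]
    exact (bound_u k R hR j h.le).trans le_self_add

/-- weight times half-derivative squared is controlled by the anisotropic norm -/
theorem Ghalf_sum_le (k : Fin d → ℝ) (R : Coeffs d) (σ : ℝ) (h : MemSob k σ (1/2) R) :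
    ∑' m, (ENNReal.ofReal (jb m ^ σ) * Ghalf k R m) ^ 2
      ≤ ENNReal.ofReal (sobNorm k σ (1/2) R ^ 2) := by
  have hnn : ∀ j, 0 ≤ wt k σ (1/2) j * ‖R j‖ ^ 2 := fun j => by
    have := one_le_jb j
    unfold wt; positivity
  unfold sobNorm
  rw [Real.sq_sqrt (tsum_nonneg hnn), ENNReal.ofReal_tsum_of_nonneg hnn h]
  refine ENNReal.tsum_le_tsum fun m => ?_
  have h1 := one_le_jb m
  unfold Ghalf
  rw [← ENNReal.ofReal_mul (by positivity), ← ENNReal.ofReal_pow (by positivity)]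
  apply ENNReal.ofReal_le_ofReal
  unfold wt
  rw [mul_pow, mul_pow, Real.sq_sqrt (abs_nonneg _), ← mul_assoc, ← Real.rpow_mul_natCast (by linarith)]
  rw [show σ * ((2 : ℕ) : ℝ) = 2 * σ by push_cast; ring]
  gcongr
  rw [← Real.sqrt_eq_rpow]
  apply Real.abs_le_sqrt
  linarith

theorem memSob_mono (k : Fin d → ℝ) (R : Coeffs d) (σ s : ℝ) (hσ : σ ≤ s)
    (h : MemSob k s (1/2) R) : MemSob k σ (1/2) R := by
  refine Summable.of_nonneg_of_le (fun j => ?_) (fun j => ?_) h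
  · have := one_le_jb j
    unfold wt; positivity
  · have := one_le_jb j
    unfold wt
    gcongr

theorem Ghalf_l1 (k : Fin d → ℝ) (R : Coeffs d) (σ : ℝ) :
    (∑' m, Ghalf k R m) ^ 2 ≤ (∑' m : Freq d, ENNReal.ofReal (jb m ^ (-2 * σ))) *
      ∑' m, (ENNReal.ofReal (jb m ^ σ) * Ghalf k R m) ^ 2 := by
  have h := enn_cs (fun m : Freq d => ENNReal.ofReal (jb m ^ (-σ)))
    (fun m => ENNReal.ofReal (jb m ^ σ) * Ghalf k R m)
  refine le_trans (le_of_eq ?_) (h.trans (le_of_eq ?_))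
  · congr 1
    refine tsum_congr fun m => ?_
    have h1 := one_le_jb m
    rw [← mul_assoc, ← ENNReal.ofReal_mul (by positivity), ← Real.rpow_add (by linarith)]
    simp
  · congr 1
    refine tsum_congr fun m => ?_
    have h1 := one_le_jb m
    rw [← ENNReal.ofReal_pow (by positivity), ← Real.rpow_mul_natCast (by linarith)]
    congr 2
    push_cast; ring

theorem weighted_a (k : Fin d → ℝ) (R : Coeffs d) (hR : Holo k R) (s : ℝ) (hs : 0 ≤ s)
    (j : Freq d) :
    ENNReal.ofReal (jb j ^ s) * ‖aCf k R j‖ₑ ≤ ENNReal.ofReal (2 * 2 ^ s) *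
      ((∑' m, (ENNReal.ofReal (jb (m + j) ^ s) * Ghalf k R (m + j)) * Ghalf k R m) +
       ∑' m, Ghalf k R (m + j) * (ENNReal.ofReal (jb m ^ s) * Ghalf k R m)) := by
  calc _ ≤ ENNReal.ofReal (jb j ^ s) * (2 * ∑' m, Ghalf k R (m + j) * Ghalf k R m) := by
        gcongr; exact bound_a k R hR j
    _ = 2 * ∑' m, ENNReal.ofReal (jb j ^ s) * (Ghalf k R (m + j) * Ghalf k R m) := by
        rw [ENNReal.tsum_mul_left]; ring
    _ ≤ 2 * ∑' m, (ENNReal.ofReal (2 ^ s) *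
          (ENNReal.ofReal (jb (m + j) ^ s) + ENNReal.ofReal (jb m ^ s))) *
            (Ghalf k R (m + j) * Ghalf k R m) := by
        gcongr with m
        have h1 := one_le_jb m
        have h2 := one_le_jb (m + j)
        rw [← ENNReal.ofReal_add (by positivity) (by positivity),
          ← ENNReal.ofReal_mul (by positivity)]
        exact ENNReal.ofReal_le_ofReal (jb_rpow_tri s hs m j)
    _ = _ := by
        rw [ENNReal.ofReal_mul (by norm_num), ← ENNReal.tsum_add, ENNReal.ofReal_ofNat, mul_assoc]
        congr 1
        rw [← ENNReal.tsum_mul_left]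
        refine tsum_congr fun m => ?_
        ring

theorem enn_add_sq (x y : ENNReal) : (x + y) ^ 2 ≤ 2 * x ^ 2 + 2 * y ^ 2 := by
  have := ENNReal.rpow_add_le_mul_rpow_add_rpow x y (p := 2) (by norm_num)
  norm_num at this
  rw [mul_add] at this
  exact this

theorem main_sum (k : Fin d → ℝ) (R : Coeffs d) (hR : Holo k R) (s : ℝ) (hs : 0 ≤ s) :
    ∑' j, (ENNReal.ofReal (jb j ^ s) * ‖aCf k R j‖ₑ) ^ 2 ≤
      ENNReal.ofReal (2 * 2 ^ s) ^ 2 * (4 * ((∑' m, Ghalf k R m) ^ 2 *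
        ∑' m, (ENNReal.ofReal (jb m ^ s) * Ghalf k R m) ^ 2)) := by
  set F : Freq d → ENNReal := fun m => ENNReal.ofReal (jb m ^ s) * Ghalf k R m with hF
  set G : Freq d → ENNReal := Ghalf k R with hG
  have hY1 := enn_young F G
  have hY2 : ∑' j, (∑' m, G (m + j) * F m) ^ 2 ≤ (∑' m, G m) ^ 2 * ∑' m, F m ^ 2 := by
    refine le_trans (le_of_eq ?_) hY1
    rw [← (Equiv.neg (Freq d)).tsum_eq]
    refine tsum_congr fun j => ?_
    congr 1
    rw [← (Equiv.addRight j).tsum_eq]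
    refine tsum_congr fun m => ?_
    simp only [Equiv.coe_addRight, Equiv.neg_apply]
    rw [add_neg_cancel_right, mul_comm]
  calc _ ≤ ∑' j, (ENNReal.ofReal (2 * 2 ^ s) *
          ((∑' m, F (m + j) * G m) + ∑' m, G (m + j) * F m)) ^ 2 := by
        refine ENNReal.tsum_le_tsum fun j => ?_
        exact pow_le_pow_left' (weighted_a k R hR s hs j) 2
    _ ≤ ∑' j, ENNReal.ofReal (2 * 2 ^ s) ^ 2 *
          (2 * (∑' m, F (m + j) * G m) ^ 2 + 2 * (∑' m, G (m + j) * F m) ^ 2) := by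
        gcongr with j
        rw [mul_pow]
        gcongr
        exact enn_add_sq _ _
    _ = ENNReal.ofReal (2 * 2 ^ s) ^ 2 * (2 * ∑' j, (∑' m, F (m + j) * G m) ^ 2 +
          2 * ∑' j, (∑' m, G (m + j) * F m) ^ 2) := by
        rw [ENNReal.tsum_mul_left, ENNReal.tsum_add, ENNReal.tsum_mul_left, ENNReal.tsum_mul_left]
    _ ≤ ENNReal.ofReal (2 * 2 ^ s) ^ 2 * (2 * ((∑' m, G m) ^ 2 * ∑' m, F m ^ 2) +
          2 * ((∑' m, G m) ^ 2 * ∑' m, F m ^ 2)) := by gcongr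
    _ = _ := by ring

/-- **Lemma 6.3(iii) (Bound for `a` in terms of `A` and `B`).** Let `s > (d+1)/2`.
There is a constant `C = C(d,s,k)` such that for every holomorphic
`R ∈ H^{s,1/2}(𝕋^d)`, the function `a := i(P̄[conj(R)·∂_α R] − P[R·∂_α conj(R)])`
satisfies `‖a‖_{H^s} ≤ C ‖R‖_{H^{s-1/2,1/2}} ‖R‖_{H^{s,1/2}}`. -/
theorem frequency_shift_AB_bound
    (d : ℕ) (hd : 1 ≤ d) (k : Fin d → ℝ) (hk : Indep k)
    (s : ℝ) (hs : ((d : ℝ) + 1) / 2 < s) :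
    ∃ C : ℝ, 0 < C ∧
      ∀ R : Coeffs d, Holo k R → MemSob k s (1/2) R →
        MemHs s (aCf k R) ∧
        HsNorm s (aCf k R) ≤ C * sobNorm k (s - 1/2) (1/2) R * sobNorm k s (1/2) R := by
  have hd1 : (1 : ℝ) ≤ d := by exact_mod_cast hd
  have hs0 : 0 ≤ s := by linarith
  have hZs : Summable (fun j : Freq d => jb j ^ (-2 * (s - 1/2))) :=
    summable_jb _ (by linarith)
  have hZnn : ∀ j : Freq d, 0 ≤ jb j ^ (-2 * (s - 1/2)) := fun j => by
    have := one_le_jb j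
    positivity
  set Z : ℝ := ∑' j : Freq d, jb j ^ (-2 * (s - 1/2)) with hZ
  have hZ0 : 0 < Z := by
    refine hZs.tsum_pos hZnn 0 ?_
    have := one_le_jb (0 : Freq d)
    positivity
  set K : ℝ := (2 * 2 ^ s) ^ 2 * (4 * Z) with hK
  have hK0 : 0 < K := by positivity
  refine ⟨Real.sqrt K, Real.sqrt_pos.mpr hK0, fun R hR hmem => ?_⟩
  set A := sobNorm k (s - 1/2) (1/2) R with hA
  set B := sobNorm k s (1/2) R with hB
  have hA0 : 0 ≤ A := Real.sqrt_nonneg _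
  have hB0 : 0 ≤ B := Real.sqrt_nonneg _
  have hnn : ∀ j, 0 ≤ jb j ^ (2 * s) * ‖aCf k R j‖ ^ 2 := fun j => by
    have := one_le_jb j
    positivity
  have hbound : ∑' j, ENNReal.ofReal (jb j ^ (2 * s) * ‖aCf k R j‖ ^ 2) ≤
      ENNReal.ofReal (K * A ^ 2 * B ^ 2) := by
    calc _ = ∑' j, (ENNReal.ofReal (jb j ^ s) * ‖aCf k R j‖ₑ) ^ 2 := by
          refine tsum_congr fun j => ?_
          have := one_le_jb j
          rw [← ofReal_norm, ← ENNReal.ofReal_mul (by positivity),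
            ← ENNReal.ofReal_pow (by positivity), mul_pow, ← Real.rpow_mul_natCast (by linarith)]
          congr 3
          push_cast; ring
      _ ≤ _ := main_sum k R hR s hs0
      _ ≤ ENNReal.ofReal (2 * 2 ^ s) ^ 2 * (4 * ((ENNReal.ofReal Z * ENNReal.ofReal (A ^ 2)) *
            ENNReal.ofReal (B ^ 2))) := by
          gcongr
          · refine (Ghalf_l1 k R (s - 1/2)).trans ?_
            rw [hZ, ENNReal.ofReal_tsum_of_nonneg hZnn hZs]
            gcongr
            exact Ghalf_sum_le k R (s - 1/2) (memSob_mono k R _ s (by linarith) hmem)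
          · exact Ghalf_sum_le k R s hmem
      _ = _ := by
          rw [← ENNReal.ofReal_ofNat 4, ← ENNReal.ofReal_pow (by positivity),
            ← ENNReal.ofReal_mul (by positivity), ← ENNReal.ofReal_mul (by positivity),
            ← ENNReal.ofReal_mul (by positivity), ← ENNReal.ofReal_mul (by positivity)]
          congr 1
          rw [hK]; ring
  have hsum : Summable (fun j => jb j ^ (2 * s) * ‖aCf k R j‖ ^ 2) := by
    have hne := ne_top_of_le_ne_top ENNReal.ofReal_ne_top hbound
    have := ENNReal.summable_toReal hne
    refine this.congr fun j => ?_
    exact ENNReal.toReal_ofReal (hnn j)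
  refine ⟨hsum, ?_⟩
  rw [← ENNReal.ofReal_tsum_of_nonneg hnn hsum,
    ENNReal.ofReal_le_ofReal_iff (by positivity)] at hbound
  unfold HsNorm
  refine (Real.sqrt_le_sqrt hbound).trans (le_of_eq ?_)
  rw [Real.sqrt_mul (by positivity), Real.sqrt_mul (by positivity), Real.sqrt_sq hA0,
    Real.sqrt_sq hB0]

end
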